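/- Jacobi triple product: Σ_{m∈ℤ} p^{m²/2} z^m = ∏_{n=1}^∞ (1 - p^n)(1 + p^{n-1/2} z)(1 + p^{n-1/2} z^{-1}), valid for 0 < |p| < 1 and z ≠ 0, where p^{1/2} is a fixed square root. -/

import Mathlib

open Complex

/-- The finite `q`-Pochhammer symbol `(p; p)_n = ∏_{k=1}^n (1 - pᵏ)`. -/
noncomputable def qPoch (p : ℂ) (n : ℕ) : ℂ := ∏ k ∈ Finset.range n, (1 - p ^ (k + 1))

/-- The reciprocal of `(p; p)_k`, extended by zero to negative integers `k`. -/
noncomputable def qPochInv (p : ℂ) (k : ℤ) : ℂ := if 0 ≤ k then (qPoch p k.toNat)⁻¹ else 0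

theorem one_sub_pow_succ_ne_zero {p : ℂ} (hp : ‖p‖ < 1) (k : ℕ) : 1 - p ^ (k + 1) ≠ 0 := by
  intro h
  have h1 : ‖p ^ (k + 1)‖ = 1 := by rw [← sub_eq_zero.mp h, norm_one]
  rw [norm_pow] at h1
  exact (pow_lt_one₀ (norm_nonneg p) hp k.succ_ne_zero).ne h1

theorem qPoch_ne_zero {p : ℂ} (hp : ‖p‖ < 1) (n : ℕ) : qPoch p n ≠ 0 :=
  Finset.prod_ne_zero_iff.mpr fun k _ => one_sub_pow_succ_ne_zero hp k

theorem qPoch_succ (p : ℂ) (n : ℕ) : qPoch p (n + 1) = qPoch p n * (1 - p ^ (n + 1)) :=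
  Finset.prod_range_succ _ _

theorem qPochInv_sub_one {p : ℂ} (hp : ‖p‖ < 1) (k : ℤ) :
    qPochInv p (k - 1) = (1 - p ^ k) * qPochInv p k := by
  rcases lt_trichotomy k 0 with hk | rfl | hk
  · simp [qPochInv, not_le.mpr hk, show ¬ (1 ≤ k) by omega]
  · simp [qPochInv]
  · obtain ⟨n, rfl⟩ : ∃ n : ℕ, k = n + 1 := ⟨(k - 1).toNat, by omega⟩
    have h1 := one_sub_pow_succ_ne_zero hp n
    have h2 := qPoch_ne_zero hp n
    have h3 : ((n : ℤ) + 1).toNat = n + 1 := by omega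
    have h4 : p ^ ((n : ℤ) + 1) = p ^ (n + 1) := by exact_mod_cast zpow_natCast p (n + 1)
    rw [add_sub_cancel_right, qPochInv, qPochInv, if_pos (by omega), if_pos (by omega), h3,
      Int.toNat_natCast, qPoch_succ, h4]
    field_simp

theorem qPoch_tendsto {p : ℂ} (hp : ‖p‖ < 1) :
    ∃ L : ℂ, L ≠ 0 ∧ Filter.Tendsto (qPoch p) Filter.atTop (nhds L) := by
  have hsum : Summable fun n : ℕ => ‖-p ^ (n + 1)‖ := by
    simpa using (summable_nat_add_iff 1).mpr (summable_geometric_of_lt_one (norm_nonneg _) hp)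
  refine ⟨∏' n : ℕ, (1 + -p ^ (n + 1)), tprod_one_add_ne_zero_of_summable ?_ hsum, ?_⟩
  · intro n
    simpa [sub_eq_add_neg] using one_sub_pow_succ_ne_zero hp n
  · simpa only [qPoch, sub_eq_add_neg] using!
      (multipliable_one_add_of_summable hsum).hasProd.tendsto_prod_nat

theorem qPochInv_tendsto {p L : ℂ} (hL : L ≠ 0)
    (h : Filter.Tendsto (qPoch p) Filter.atTop (nhds L)) :
    Filter.Tendsto (qPochInv p) Filter.atTop (nhds L⁻¹) := by
  have hnat : Filter.Tendsto Int.toNat Filter.atTop Filter.atTop :=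
    Filter.tendsto_atTop.mpr fun n => by
      filter_upwards [Filter.eventually_ge_atTop (n : ℤ)] with k hk
      omega
  refine ((h.inv₀ hL).comp hnat).congr' ?_
  filter_upwards [Filter.eventually_ge_atTop (0 : ℤ)] with k hk
  simp [qPochInv, hk]

theorem exists_norm_le_of_tendsto {u : ℕ → ℂ} {L : ℂ}
    (h : Filter.Tendsto u Filter.atTop (nhds L)) : ∃ C, 0 ≤ C ∧ ∀ n, ‖u n‖ ≤ C := by
  obtain ⟨C, hC⟩ := (Metric.isBounded_range_of_tendsto u h).exists_norm_le
  have hC' : ∀ n, ‖u n‖ ≤ C := fun n => hC _ ⟨n, rfl⟩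
  exact ⟨C, (norm_nonneg _).trans (hC' 0), hC'⟩

theorem exists_norm_qPochInv_le {p L : ℂ} (hL : L ≠ 0)
    (h : Filter.Tendsto (qPoch p) Filter.atTop (nhds L)) :
    ∃ C, 0 ≤ C ∧ ∀ k, ‖qPochInv p k‖ ≤ C := by
  obtain ⟨C, hC0, hC⟩ := exists_norm_le_of_tendsto (h.inv₀ hL)
  refine ⟨C, hC0, fun k => ?_⟩
  unfold qPochInv
  split_ifs
  · exact hC _
  · simpa using hC0

/-- The coefficient recurrence behind the finite form of the triple product. -/
theorem qBinomial_recurrence {s : ℂ} (hs : s ≠ 0) (hs1 : ‖s ^ 2‖ < 1) (N : ℕ) (m : ℤ) :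
    qPoch (s ^ 2) (2 * (N + 1)) * qPochInv (s ^ 2) ((N + 1 : ℕ) + m) *
        qPochInv (s ^ 2) ((N + 1 : ℕ) - m) * s ^ (m ^ 2) =
      qPoch (s ^ 2) (2 * N) *
        ((1 + s ^ (4 * N + 2)) *
            (qPochInv (s ^ 2) (N + m) * qPochInv (s ^ 2) (N - m) * s ^ (m ^ 2)) +
          s ^ (2 * N + 1) *
            (qPochInv (s ^ 2) (N + (m - 1)) * qPochInv (s ^ 2) (N - (m - 1)) *
                s ^ ((m - 1) ^ 2) +
              qPochInv (s ^ 2) (N + (m + 1)) * qPochInv (s ^ 2) (N - (m + 1)) *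
                s ^ ((m + 1) ^ 2))) := by
  have e1 : qPochInv (s ^ 2) (N + m) =
      (1 - (s ^ 2) ^ ((N : ℤ) + 1 + m)) * qPochInv (s ^ 2) (N + 1 + m) := by
    rw [← qPochInv_sub_one hs1]; congr 1; ring
  have e2 : qPochInv (s ^ 2) (N - m) =
      (1 - (s ^ 2) ^ ((N : ℤ) + 1 - m)) * qPochInv (s ^ 2) (N + 1 - m) := by
    rw [← qPochInv_sub_one hs1]; congr 1; ring
  have e3 : qPochInv (s ^ 2) (N + (m - 1)) =
      (1 - (s ^ 2) ^ ((N : ℤ) + m)) * qPochInv (s ^ 2) (N + m) := by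
    rw [← qPochInv_sub_one hs1]; congr 1; ring
  have e4 : qPochInv (s ^ 2) (N - (m + 1)) =
      (1 - (s ^ 2) ^ ((N : ℤ) - m)) * qPochInv (s ^ 2) (N - m) := by
    rw [← qPochInv_sub_one hs1]; congr 1; ring
  have e5 : (N : ℤ) - (m - 1) = N + 1 - m := by ring
  have e6 : (N : ℤ) + (m + 1) = N + 1 + m := by ring
  have hs2 : s ^ 2 ≠ 0 := pow_ne_zero 2 hs
  have hm1 : s ^ ((m - 1) ^ 2) = s ^ (m ^ 2) * s * ((s ^ m) ^ 2)⁻¹ := by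
    rw [show (m - 1) ^ 2 = m ^ 2 + 1 - m * 2 by ring, zpow_sub₀ hs, zpow_add₀ hs, zpow_one,
      zpow_mul, div_eq_mul_inv]
    norm_cast
  have hm2 : s ^ ((m + 1) ^ 2) = s ^ (m ^ 2) * s * (s ^ m) ^ 2 := by
    rw [show (m + 1) ^ 2 = m ^ 2 + 1 + m * 2 by ring, zpow_add₀ hs, zpow_add₀ hs, zpow_one,
      zpow_mul]
    norm_cast
  have hp : (s ^ 2) ^ m = (s ^ m) ^ 2 := by
    rw [← zpow_natCast, ← zpow_natCast, ← zpow_mul, ← zpow_mul, mul_comm]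
  have hu : s ^ m ≠ 0 := zpow_ne_zero m hs
  rw [show 2 * (N + 1) = 2 * N + 1 + 1 by ring, qPoch_succ, qPoch_succ]
  rw [e3, e4, e1, e2, e5, e6, hm1, hm2]
  push_cast
  simp only [zpow_add₀ hs2, zpow_sub₀ hs2, zpow_natCast, zpow_one, hp]
  generalize s ^ m = u at *
  field_simp
  ring

/-- The finite form of the Jacobi triple product. -/
theorem hasSum_finite_jacobi {s z : ℂ} (hs : s ≠ 0) (hs1 : ‖s ^ 2‖ < 1) (hz : z ≠ 0) (N : ℕ) :
    HasSum (fun m : ℤ => qPoch (s ^ 2) (2 * N) * qPochInv (s ^ 2) (N + m) *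
        qPochInv (s ^ 2) (N - m) * s ^ (m ^ 2) * z ^ m)
      (∏ n ∈ Finset.range N, (1 + s ^ (2 * n + 1) * z) * (1 + s ^ (2 * n + 1) * z⁻¹)) := by
  induction N with
  | zero =>
    have h := hasSum_single (f := fun m : ℤ => qPoch (s ^ 2) (2 * 0) *
      qPochInv (s ^ 2) ((0 : ℕ) + m) * qPochInv (s ^ 2) ((0 : ℕ) - m) * s ^ (m ^ 2) * z ^ m) 0
      fun m hm => by
        rcases lt_or_gt_of_ne hm with h | h <;> simp [qPochInv, not_le.mpr h]
    convert! h using 1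
    simp [qPoch, qPochInv]
  | succ N ih =>
    have h1 := (Equiv.subRight (1 : ℤ)).hasSum_iff.mpr ih
    have h2 := (Equiv.addRight (1 : ℤ)).hasSum_iff.mpr ih
    have h := ((ih.mul_left (1 + s ^ (4 * N + 2))).add (h1.mul_left (s ^ (2 * N + 1) * z))).add
      (h2.mul_left (s ^ (2 * N + 1) * z⁻¹))
    rw [Finset.prod_range_succ]
    convert! h using 1
    · funext m
      rw [qBinomial_recurrence hs hs1]
      simp only [Function.comp_apply, Equiv.subRight_apply, Equiv.coe_addRight,
        zpow_sub_one₀ hz, zpow_add_one₀ hz]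
      field_simp
      ring
    · field_simp
      ring_nf

theorem summable_zpow_sq_mul_zpow {s z : ℂ} (hs : s ≠ 0) (hs1 : ‖s‖ < 1) (hz : z ≠ 0) :
    Summable fun m : ℤ => s ^ (m ^ 2) * z ^ m := by
  have hpi : (Real.pi : ℂ) ≠ 0 := by exact_mod_cast Real.pi_ne_zero
  have him : 0 < (log s / (Real.pi * I)).im := by
    have : log s / (Real.pi * I) = -(log s * I) / (Real.pi : ℝ) := by
      field_simp
      simp
    rw [this, div_ofReal_im]
    have hlog : Real.log ‖s‖ < 0 := Real.log_neg (norm_pos_iff.mpr hs) hs1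
    have : 0 < (-(log s * I)).im := by simpa [log_re] using hlog
    exact div_pos this Real.pi_pos
  refine ((summable_jacobiTheta₂_term_iff (log z / (2 * Real.pi * I)) _).mpr him).congr
    fun m => ?_
  have h : 2 * Real.pi * I * m * (log z / (2 * Real.pi * I)) +
      Real.pi * I * m ^ 2 * (log s / (Real.pi * I)) =
        ((m ^ 2 : ℤ) : ℂ) * log s + (m : ℂ) * log z := by
    have := I_ne_zero
    push_cast
    field_simp
    ring
  rw [jacobiTheta₂_term, h, exp_add, exp_int_mul, exp_int_mul, exp_log hs, exp_log hz]

theorem multipliable_one_add_odd_pow_mul {s : ℂ} (hs1 : ‖s‖ < 1) (w : ℂ) :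
    Multipliable fun n : ℕ => 1 + s ^ (2 * n + 1) * w := by
  apply multipliable_one_add_of_summable
  have h : Summable fun n : ℕ => ‖s‖ ^ n :=
    summable_geometric_of_lt_one (norm_nonneg _) hs1
  simpa using (h.comp_injective (i := fun n : ℕ => 2 * n + 1)
    (fun a b hab => by simpa using hab)).mul_right ‖w‖

/-- The Jacobi triple product identity
`Σ_{m∈ℤ} p^{m²/2} zᵐ = ∏_{n≥1} (1-pⁿ)(1+p^{n-1/2}z)(1+p^{n-1/2}z⁻¹)`,
where `s` is a fixed square root of `p` (so `p^{m²/2} = s^{m²}` and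
`p^{n-1/2} = s^{2n-1}`). -/
theorem jacobi_triple_product (p s z : ℂ)
    (hp0 : 0 < ‖p‖) (hp1 : ‖p‖ < 1) (hs : s ^ 2 = p) (hz : z ≠ 0) :
    ∑' m : ℤ, s ^ (m ^ 2) * z ^ m =
      ∏' n : ℕ, (1 - p ^ (n + 1)) * (1 + s ^ (2 * n + 1) * z) *
        (1 + s ^ (2 * n + 1) * z⁻¹) := by
  subst hs
  have hs0 : s ≠ 0 := by
    rintro rfl
    simp at hp0
  have hs1 : ‖s‖ < 1 := by
    rw [norm_pow] at hp1
    exact (pow_lt_one_iff_of_nonneg (norm_nonneg s) two_ne_zero).mp hp1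
  have hprod := ((ModularForm.multipliable_one_sub_pow hp1).mul
    (multipliable_one_add_odd_pow_mul hs1 z)).mul (multipliable_one_add_odd_pow_mul hs1 z⁻¹)
  obtain ⟨L, hL, hP⟩ := qPoch_tendsto hp1
  have hR := qPochInv_tendsto hL hP
  obtain ⟨C, hC0, hC⟩ := exists_norm_le_of_tendsto hP
  obtain ⟨D, hD0, hD⟩ := exists_norm_qPochInv_le hL hP
  have hsum := (summable_zpow_sq_mul_zpow hs0 hs1 hz).norm.mul_left (C * (C * D * D))
  have hlim := tendsto_tsum_of_dominated_convergence (𝓕 := Filter.atTop)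
    (f := fun (N : ℕ) (m : ℤ) => qPoch (s ^ 2) N * (qPoch (s ^ 2) (2 * N) *
      qPochInv (s ^ 2) (N + m) * qPochInv (s ^ 2) (N - m) * s ^ (m ^ 2) * z ^ m))
    (g := fun m : ℤ => s ^ (m ^ 2) * z ^ m) hsum ?_ ?_
  · refine tendsto_nhds_unique hlim (hprod.hasProd.tendsto_prod_nat.congr fun N => ?_)
    rw [((hasSum_finite_jacobi hs0 hp1 hz N).mul_left (qPoch (s ^ 2) N)).tsum_eq, qPoch,
      ← Finset.prod_mul_distrib]
    simp only [mul_assoc]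
  · intro m
    have hcast : Filter.Tendsto (fun N : ℕ => (N : ℤ)) Filter.atTop Filter.atTop :=
      tendsto_natCast_atTop_atTop
    have hadd := hR.comp (Filter.tendsto_atTop_add_const_right _ m hcast)
    have hsub := hR.comp (Filter.tendsto_atTop_add_const_right _ (-m) hcast)
    have hdbl := hP.comp (Filter.tendsto_id.const_mul_atTop' (two_pos : (0 : ℕ) < 2))
    have h := hP.mul ((((hdbl.mul hadd).mul hsub).mul_const (s ^ (m ^ 2))).mul_const (z ^ m))
    convert! h using 2
    field_simp
  · refine Filter.Eventually.of_forall fun N m => ?_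
    rw [mul_assoc (_ * _) (s ^ (m ^ 2)), ← mul_assoc, norm_mul]
    gcongr
    rw [norm_mul, norm_mul, norm_mul]
    gcongr
    exacts [hC _, hC _, hD _, hD _]
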